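/- Suppose 0 < γ < λ < 1 with λ > 1/m and γλ < 1/m, and let s = 1 + log(mλ)/log(1/γ). For a finite word u = u(1)…u(k) over {1,…,m} write φ_u = φ_{u(1)} ∘ … ∘ φ_{u(k)}. Assume that for every ε > 0 there exist distinct finite words u ≠ v of equal length such that the affine map (φ_u)^{-1} ∘ φ_v is ε-close to the identity, in the sense that its linear part L and translation vector t satisfy ‖L − I‖ + |t| < ε (operator norm and Euclidean norm). Then the s-dimensional Hausdorff measure of K_{γ,λ} is zero. -/

import Mathlib

open MeasureTheory Filter Set
open scoped ENNReal Topology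

noncomputable section

/-- The self-affine set `K_{γ,λ}` for a digit set `d : Fin m → ℝ`. -/
def Kaff (m : ℕ) (d : Fin m → ℝ) (g l : ℝ) : Set (ℝ × ℝ) :=
  {p | ∃ ω : ℕ → Fin m, p = (∑' n, d (ω n) * g ^ n, ∑' n, d (ω n) * l ^ n)}

/-- The affine map `φ(x,y) = (γx + t, λy + t)`. -/
def phiMap (g l t : ℝ) : ℝ × ℝ → ℝ × ℝ := fun p => (g * p.1 + t, l * p.2 + t)

/-- `φ_u = φ_{u(1)} ∘ … ∘ φ_{u(k)}` for a finite word `u`. -/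
def phiWord (m : ℕ) (d : Fin m → ℝ) (g l : ℝ) : List (Fin m) → ℝ × ℝ → ℝ × ℝ
  | [] => id
  | i :: u => phiMap g l (d i) ∘ phiWord m d g l u


theorem phiWord_eq (m : ℕ) (d : Fin m → ℝ) (g l : ℝ) (u : List (Fin m)) (p : ℝ × ℝ) :
    phiWord m d g l u p = (g ^ u.length * p.1 + (phiWord m d g l u 0).1,
      l ^ u.length * p.2 + (phiWord m d g l u 0).2) := by
  induction u with
  | nil => simp [phiWord]
  | cons i u ih =>
    simp only [phiWord, Function.comp, phiMap, List.length_cons]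
    rw [ih]
    ext <;> simp <;> ring

theorem phiWord_append (m : ℕ) (d : Fin m → ℝ) (g l : ℝ) (u v : List (Fin m)) :
    phiWord m d g l (u ++ v) = phiWord m d g l u ∘ phiWord m d g l v := by
  induction u with
  | nil => simp [phiWord]
  | cons i u ih =>
    simp only [phiWord, List.cons_append, ih]
    rfl

theorem exists_bound {m : ℕ} (d : Fin m → ℝ) : ∃ D : ℝ, 0 ≤ D ∧ ∀ i, |d i| ≤ D :=
  ⟨∑ i, |d i|, Finset.sum_nonneg fun _ _ => abs_nonneg _, fun i =>
    Finset.single_le_sum (f := fun i => |d i|) (fun _ _ => abs_nonneg _) (Finset.mem_univ i)⟩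

theorem digit_summable {m : ℕ} (d : Fin m → ℝ) {g : ℝ} (hg : 0 < g) (hg1 : g < 1)
    (ω : ℕ → Fin m) : Summable fun n => d (ω n) * g ^ n := by
  obtain ⟨D, hD, h⟩ := exists_bound d
  refine Summable.of_norm_bounded ((summable_geometric_of_lt_one hg.le hg1).mul_left D) fun n => ?_
  rw [Real.norm_eq_abs, abs_mul, abs_of_pos (pow_pos hg n)]
  exact mul_le_mul_of_nonneg_right (h _) (by positivity)

theorem digit_shift {m : ℕ} (d : Fin m → ℝ) {g : ℝ} (hg : 0 < g) (hg1 : g < 1)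
    (ω : ℕ → Fin m) : ∑' n, d (ω n) * g ^ n = g * ∑' n, d (ω (n + 1)) * g ^ n + d (ω 0) := by
  rw [(digit_summable d hg hg1 ω).tsum_eq_zero_add, ← tsum_mul_left, add_comm]
  simp only [pow_zero, mul_one, pow_succ]
  congr 1
  refine tsum_congr fun n => by ring

theorem digit_bound {m : ℕ} (d : Fin m → ℝ) {g l D : ℝ} (hg : 0 < g) (hgl : g ≤ l) (hl1 : l < 1)
    (h0 : ∀ i, 0 ≤ d i) (hD : ∀ i, |d i| ≤ D)
    (ω : ℕ → Fin m) : ∑' n, d (ω n) * g ^ n ∈ Icc 0 (D * (1 - l)⁻¹) := by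
  have hl : 0 < l := hg.trans_le hgl
  refine ⟨tsum_nonneg fun n => mul_nonneg (h0 _) (by positivity), ?_⟩
  rw [← tsum_geometric_of_lt_one hl.le hl1, ← tsum_mul_left]
  refine (digit_summable d hg (hgl.trans_lt hl1) ω).tsum_le_tsum (fun n => ?_)
    ((summable_geometric_of_lt_one hl.le hl1).mul_left D)
  have := (le_abs_self _).trans (hD (ω n))
  exact mul_le_mul this (by gcongr) (by positivity) ((abs_nonneg _).trans (hD (ω n)))

theorem Kaff_subset {m : ℕ} (d : Fin m → ℝ) {g l : ℝ} (hg : 0 < g) (hgl : g < l) (hl1 : l < 1)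
    (k : ℕ) : Kaff m d g l ⊆
      ⋃ v : List.Vector (Fin m) k, phiWord m d g l v.toList '' Kaff m d g l := by
  induction k with
  | zero =>
    intro p hp
    exact mem_iUnion.2 ⟨List.Vector.nil, p, hp, rfl⟩
  | succ k ih =>
    rintro p ⟨ω, rfl⟩
    have h1 : ((∑' n, d (ω (n+1)) * g ^ n, ∑' n, d (ω (n+1)) * l ^ n) : ℝ × ℝ) ∈ Kaff m d g l :=
      ⟨fun n => ω (n + 1), rfl⟩
    obtain ⟨v, q, hq, hv⟩ := mem_iUnion.1 (ih h1)
    refine mem_iUnion.2 ⟨List.Vector.cons (ω 0) v, q, hq, ?_⟩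
    rw [List.Vector.toList_cons]
    simp only [phiWord, Function.comp, hv, phiMap]
    rw [digit_shift d hg (hgl.trans hl1) ω, digit_shift d (hg.trans hgl) hl1 ω]

theorem rpow_key {m : ℕ} (hm : 2 ≤ m) {g l : ℝ} (hg : 0 < g) (hgl : g < l) (hl1 : l < 1) :
    g ^ (1 + Real.log (m * l) / Real.log (1 / g)) = g / (m * l) := by
  have hm0 : (0 : ℝ) < m := by exact_mod_cast (by omega : 0 < m)
  have hl : 0 < l := hg.trans hgl
  have hlog : Real.log g ≠ 0 := (Real.log_neg hg (hgl.trans hl1)).ne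
  rw [Real.rpow_add hg, Real.rpow_one, Real.rpow_def_of_pos hg, one_div, Real.log_inv]
  have : Real.log g * (Real.log (m * l) / -Real.log g) = - Real.log (m * l) := by
    field_simp
  rw [this, Real.exp_neg, Real.exp_log (by positivity)]
  rfl

/-- The pre-measure at scale `r`. -/
def preH (s : ℝ) (r : ℝ≥0∞) : OuterMeasure (ℝ × ℝ) :=
  OuterMeasure.mkMetric'.pre (fun A => Metric.ediam A ^ s) r

theorem square_cost {s : ℝ} (hs : 0 ≤ s) {r : ℝ≥0∞} (a b e : ℝ)
    (hr : ENNReal.ofReal e ≤ r) :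
    preH s r (Icc a (a + e) ×ˢ Icc b (b + e)) ≤ ENNReal.ofReal e ^ s := by
  have h : Metric.ediam (Icc a (a + e) ×ˢ Icc b (b + e)) ≤ ENNReal.ofReal e := by
    refine Metric.ediam_le_of_forall_dist_le fun x hx y hy => ?_
    obtain ⟨⟨h1, h2⟩, h3, h4⟩ := hx
    obtain ⟨⟨h5, h6⟩, h7, h8⟩ := hy
    rw [Prod.dist_eq, Real.dist_eq, Real.dist_eq]
    refine max_le (abs_le.2 ⟨?_, ?_⟩) (abs_le.2 ⟨?_, ?_⟩) <;> linarith
  exact (OuterMeasure.mkMetric'.pre_le (h.trans hr)).trans (ENNReal.rpow_le_rpow h hs)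

theorem rect_cost {m : ℕ} (hm : 2 ≤ m) {g l : ℝ} (hg : 0 < g) (hgl : g < l) (hl1 : l < 1)
    {s : ℝ} (hs : s = 1 + Real.log (m * l) / Real.log (1 / g)) (hs0 : 0 ≤ s)
    {B : ℝ} (hB : 0 < B) (n : ℕ) {r : ℝ≥0∞} (hr : ENNReal.ofReal (B * g ^ n) ≤ r)
    (a b : ℝ) (A : Set (ℝ × ℝ))
    (hA : ∀ p ∈ A, p.1 ∈ Icc a (a + B * g ^ n) ∧ p.2 ∈ Icc b (b + B * l ^ n)) :
    preH s r A ≤ ENNReal.ofReal (2 * B ^ s / m ^ n) := by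
  have hm0 : (0 : ℝ) < m := by exact_mod_cast (by omega : 0 < m)
  have hl : 0 < l := hg.trans hgl
  set e := B * g ^ n with he
  have he0 : 0 < e := by positivity
  set x := (l / g) ^ n with hx
  have hx1 : 1 ≤ x := one_le_pow₀ (by rw [le_div_iff₀ hg]; linarith)
  have hxe : B * l ^ n = x * e := by
    rw [hx, he, div_pow]; field_simp
  have hsub : A ⊆ ⋃ i ∈ Finset.range (⌊x⌋₊ + 1),
      Icc a (a + e) ×ˢ Icc (b + i * e) (b + i * e + e) := by
    intro p hp
    obtain ⟨h1, h2, h3⟩ := hA p hp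
    have hy : 0 ≤ (p.2 - b) / e := div_nonneg (by linarith) he0.le
    refine mem_iUnion₂.2 ⟨⌊(p.2 - b) / e⌋₊, ?_, h1, ?_, ?_⟩
    · rw [Finset.mem_range, Nat.lt_succ_iff]
      apply Nat.floor_mono
      rw [div_le_iff₀ he0]; linarith
    · have := Nat.floor_le hy
      rw [le_div_iff₀ he0] at this; linarith
    · have := (Nat.lt_floor_add_one ((p.2 - b) / e)).le
      rw [div_le_iff₀ he0] at this; linarith
  have hes : e ^ s = B ^ s * (g / (m * l)) ^ n := by
    rw [he, Real.mul_rpow hB.le (by positivity), ← Real.rpow_natCast g n, ← Real.rpow_mul hg.le,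
      mul_comm (n : ℝ) s, Real.rpow_mul hg.le, Real.rpow_natCast, hs, rpow_key hm hg hgl hl1]
  calc preH s r A ≤ preH s r (⋃ i ∈ Finset.range (⌊x⌋₊ + 1),
      Icc a (a + e) ×ˢ Icc (b + i * e) (b + i * e + e)) := measure_mono hsub
    _ ≤ ∑ i ∈ Finset.range (⌊x⌋₊ + 1), preH s r
        (Icc a (a + e) ×ˢ Icc (b + i * e) (b + i * e + e)) := measure_biUnion_finset_le _ _
    _ ≤ ∑ i ∈ Finset.range (⌊x⌋₊ + 1), ENNReal.ofReal e ^ s :=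
        Finset.sum_le_sum fun i _ => square_cost hs0 _ _ _ hr
    _ = ENNReal.ofReal ((⌊x⌋₊ + 1 : ℕ) * e ^ s) := by
        rw [Finset.sum_const, Finset.card_range, nsmul_eq_mul, ENNReal.ofReal_mul (Nat.cast_nonneg (⌊x⌋₊ + 1)),
          ENNReal.ofReal_natCast, ENNReal.ofReal_rpow_of_pos he0]
    _ ≤ ENNReal.ofReal (2 * B ^ s / m ^ n) := by
        apply ENNReal.ofReal_le_ofReal
        have h2 : ((⌊x⌋₊ + 1 : ℕ) : ℝ) ≤ 2 * x := by
          have := Nat.floor_le (by linarith : 0 ≤ x)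
          push_cast; linarith
        calc ((⌊x⌋₊ + 1 : ℕ) : ℝ) * e ^ s ≤ 2 * x * e ^ s := by gcongr
          _ = 2 * B ^ s / m ^ n := by
            rw [hes, hx, div_pow, div_pow, mul_pow]; field_simp

/-- Relative closeness of two cylinders of level `k`. -/
def RelClose (m : ℕ) (d : Fin m → ℝ) (g l c : ℝ) (k : ℕ) (u v : List (Fin m)) : Prop :=
  |(phiWord m d g l u 0).1 - (phiWord m d g l v 0).1| ≤ c * g ^ k ∧
  |(phiWord m d g l u 0).2 - (phiWord m d g l v 0).2| ≤ c * l ^ k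

theorem close_pair {m : ℕ} {d : Fin m → ℝ} {g l : ℝ} (hg : 0 < g) (hgl : g < l)
    (hclose : ∀ ε : ℝ, 0 < ε → ∃ u v : List (Fin m), u.length = v.length ∧ u ≠ v ∧
      ∃ (L : (ℝ × ℝ) →L[ℝ] (ℝ × ℝ)) (t : ℝ × ℝ),
        (∀ p : ℝ × ℝ, phiWord m d g l u (L p + t) = phiWord m d g l v p) ∧
        ‖L - ContinuousLinearMap.id ℝ (ℝ × ℝ)‖ + ‖t‖ < ε) (ε : ℝ) (hε : 0 < ε) :
    ∃ (j : ℕ) (u v : List.Vector (Fin m) j), u ≠ v ∧ RelClose m d g l ε j u.toList v.toList := by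
  obtain ⟨u, v, huv, hne, L, t, h, hlt⟩ := hclose ε hε
  have hl : 0 < l := hg.trans hgl
  have ht : ‖t‖ ≤ ε := by linarith [norm_nonneg (L - ContinuousLinearMap.id ℝ (ℝ × ℝ))]
  have h1 : |t.1| ≤ ε := (norm_fst_le t).trans ht
  have h2 : |t.2| ≤ ε := (norm_snd_le t).trans ht
  refine ⟨u.length, ⟨u, rfl⟩, ⟨v, huv.symm⟩, fun h => hne (congrArg Subtype.val h), ?_⟩
  have h0 := h 0
  rw [map_zero, zero_add, phiWord_eq] at h0
  change RelClose m d g l ε u.length u v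
  rw [RelClose, ← h0]
  simp only [sub_add_cancel_right, abs_neg, abs_mul, abs_of_pos (pow_pos hg _),
    abs_of_pos (pow_pos hl _)]
  constructor
  · rw [mul_comm]; gcongr
  · rw [mul_comm]; gcongr

theorem relClose_append {m : ℕ} {d : Fin m → ℝ} {g l c c' : ℝ} (hg : 0 < g) (hgl : g < l)
    {j k : ℕ} {u v : List.Vector (Fin m) j} {w w' : List.Vector (Fin m) k}
    (h1 : RelClose m d g l (c' * g ^ k) j u.toList v.toList)
    (h2 : RelClose m d g l c k w.toList w'.toList) (hc : 0 ≤ c') :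
    RelClose m d g l (c + c') (j + k) (u.toList ++ w.toList) (v.toList ++ w'.toList) := by
  have hl : 0 < l := hg.trans hgl
  obtain ⟨h3, h4⟩ := h1
  obtain ⟨h5, h6⟩ := h2
  have hgk : c' * g ^ k * l ^ j ≤ c' * l ^ k * l ^ j := by gcongr
  simp only [RelClose, phiWord_append, Function.comp]
  rw [phiWord_eq m d g l u.toList (phiWord m d g l w.toList 0),
    phiWord_eq m d g l v.toList (phiWord m d g l w'.toList 0)]
  simp only [List.Vector.toList_length]
  set a := phiWord m d g l u.toList 0
  set b := phiWord m d g l v.toList 0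
  set a' := phiWord m d g l w.toList 0
  set b' := phiWord m d g l w'.toList 0
  have h7 : |g ^ j * (a'.1 - b'.1)| ≤ g ^ j * (c * g ^ k) := by
    rw [abs_mul, abs_of_pos (pow_pos hg _)]; gcongr
  have h8 : |l ^ j * (a'.2 - b'.2)| ≤ l ^ j * (c * l ^ k) := by
    rw [abs_mul, abs_of_pos (pow_pos hl _)]; gcongr
  constructor
  · calc _ = |g ^ j * (a'.1 - b'.1) + (a.1 - b.1)| := by congr 1; ring
      _ ≤ _ := (abs_add_le _ _).trans (add_le_add h7 h3)
      _ = _ := by rw [pow_add]; ring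
  · calc _ = |l ^ j * (a'.2 - b'.2) + (a.2 - b.2)| := by congr 1; ring
      _ ≤ _ := (abs_add_le _ _).trans (add_le_add h8 (h4.trans hgk))
      _ = _ := by rw [pow_add]; ring

theorem relClose_self {m : ℕ} {d : Fin m → ℝ} {g l c : ℝ} (hg : 0 < g) (hgl : g < l)
    (hc : 0 ≤ c) (k : ℕ) (u : List (Fin m)) : RelClose m d g l c k u u := by
  have hl : 0 < l := hg.trans hgl
  constructor <;> simp <;> positivity

theorem RelClose.symm {m : ℕ} {d : Fin m → ℝ} {g l c : ℝ} {k : ℕ} {u v : List (Fin m)}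
    (h : RelClose m d g l c k u v) : RelClose m d g l c k v u := by
  unfold RelClose at *
  rwa [abs_sub_comm, abs_sub_comm (phiWord m d g l v 0).2]

theorem many_close {m : ℕ} {d : Fin m → ℝ} {g l : ℝ} (hg : 0 < g) (hgl : g < l)
    (hpair : ∀ ε : ℝ, 0 < ε → ∃ (j : ℕ) (u v : List.Vector (Fin m) j), u ≠ v ∧
      RelClose m d g l ε j u.toList v.toList) (N : ℕ) :
    ∃ (k : ℕ) (c : ℝ) (W : Finset (List.Vector (Fin m) k)), 0 ≤ c ∧ c < 1 ∧ W.card = 2 ^ N ∧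
      ∀ w ∈ W, ∀ w' ∈ W, RelClose m d g l c k w.toList w'.toList := by
  induction N with
  | zero =>
    refine ⟨0, 0, {List.Vector.nil}, le_rfl, one_pos, by simp, ?_⟩
    intro w hw w' hw'
    rw [Finset.mem_singleton] at hw hw'
    subst hw hw'
    exact relClose_self hg hgl le_rfl _ _
  | succ N ih =>
    obtain ⟨k, c, W, hc0, hc1, hcard, hW⟩ := ih
    have hc' : 0 < (1 - c) / 2 := by linarith
    obtain ⟨j, u, v, huv, hr⟩ := hpair ((1 - c) / 2 * g ^ k) (by positivity)
    classical
    have hinj : ∀ u : List.Vector (Fin m) j,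
        Function.Injective fun w : List.Vector (Fin m) k => u ++ w := by
      intro u w w' h
      have := congrArg List.Vector.toList h
      simp only [List.Vector.toList_append] at this
      exact Subtype.ext (List.append_cancel_left this)
    refine ⟨j + k, c + (1 - c) / 2, W.image (fun w => u ++ w) ∪ W.image (fun w => v ++ w),
      by linarith, by linarith, ?_, ?_⟩
    · rw [Finset.card_union_of_disjoint, Finset.card_image_of_injective _ (hinj u),
        Finset.card_image_of_injective _ (hinj v), hcard]
      · ring
      · rw [Finset.disjoint_left]
        intro x hx hx'
        obtain ⟨w, _, rfl⟩ := Finset.mem_image.1 hx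
        obtain ⟨w', _, h⟩ := Finset.mem_image.1 hx'
        have := congrArg List.Vector.toList h
        simp only [List.Vector.toList_append] at this
        exact huv (Subtype.ext (List.append_inj_left this (by simp)).symm)
    · have key : ∀ x ∈ W.image (fun w => u ++ w) ∪ W.image (fun w => v ++ w),
          ∃ z ∈ ({u, v} : Set (List.Vector (Fin m) j)), ∃ w ∈ W, x = z ++ w := by
        intro x hx
        rcases Finset.mem_union.1 hx with h | h <;> obtain ⟨w, hw, rfl⟩ := Finset.mem_image.1 h
        · exact ⟨u, by simp, w, hw, rfl⟩
        · exact ⟨v, by simp, w, hw, rfl⟩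
      intro x hx y hy
      obtain ⟨z, hz, w, hw, rfl⟩ := key x hx
      obtain ⟨z', hz', w', hw', rfl⟩ := key y hy
      rw [List.Vector.toList_append, List.Vector.toList_append]
      refine relClose_append hg hgl ?_ (hW w hw w' hw') hc'.le
      rcases hz with rfl | rfl <;> rcases hz' with rfl | rfl
      · exact relClose_self hg hgl (by positivity) _ _
      · exact hr
      · exact hr.symm
      · exact relClose_self hg hgl (by positivity) _ _

theorem coord_bound {g q aw a0 ap B0 c : ℝ} {n k : ℕ} (hg : 0 < g) (hq : q ∈ Icc 0 B0)
    (hc : c ≤ 1) (h : |aw - a0| ≤ c * g ^ k) :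
    g ^ n * (g ^ k * q + aw) + ap ∈ Icc (ap + g ^ n * a0 - g ^ (n + k))
      (ap + g ^ n * a0 - g ^ (n + k) + (B0 + 2) * g ^ (n + k)) := by
  have hk : 0 < g ^ k := by positivity
  have hn : 0 < g ^ n := by positivity
  have h' : |aw - a0| ≤ g ^ k := h.trans (by nlinarith)
  obtain ⟨h1, h2⟩ := abs_le.1 h'
  have e1 : 0 ≤ g ^ k * q := mul_nonneg hk.le hq.1
  have e2 : g ^ k * q ≤ g ^ k * B0 := by gcongr; exact hq.2
  have e3 : 0 ≤ g ^ n * (g ^ k * q + aw - a0 + g ^ k) := mul_nonneg hn.le (by linarith)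
  have e4 : 0 ≤ g ^ n * (g ^ k * B0 + g ^ k - (g ^ k * q + aw - a0)) :=
    mul_nonneg hn.le (by linarith)
  rw [pow_add]
  constructor <;> nlinarith

theorem cluster_cost {m : ℕ} (hm : 2 ≤ m) {d : Fin m → ℝ} {g l : ℝ} (hg : 0 < g) (hgl : g < l)
    (hl1 : l < 1) {s : ℝ} (hs : s = 1 + Real.log (m * l) / Real.log (1 / g)) (hs0 : 0 ≤ s)
    {B0 : ℝ} (hB0 : 0 ≤ B0) (hK : ∀ q ∈ Kaff m d g l, q.1 ∈ Icc 0 B0 ∧ q.2 ∈ Icc 0 B0)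
    {r : ℝ≥0∞} (p : List (Fin m)) (k : ℕ)
    (hr : ENNReal.ofReal ((B0 + 2) * g ^ (p.length + k)) ≤ r)
    {c : ℝ} (hc : c ≤ 1) (w0 : List (Fin m)) (A : Set (ℝ × ℝ))
    (hA : ∀ z ∈ A, ∃ w : List (Fin m), w.length = k ∧ RelClose m d g l c k w w0 ∧
      ∃ q ∈ Kaff m d g l, z = phiWord m d g l p (phiWord m d g l w q)) :
    preH s r A ≤ ENNReal.ofReal (2 * (B0 + 2) ^ s / m ^ (p.length + k)) := by
  have hl : 0 < l := hg.trans hgl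
  refine rect_cost hm hg hgl hl1 hs hs0 (by linarith) _ hr
    ((phiWord m d g l p 0).1 + g ^ p.length * (phiWord m d g l w0 0).1 - g ^ (p.length + k))
    ((phiWord m d g l p 0).2 + l ^ p.length * (phiWord m d g l w0 0).2 - l ^ (p.length + k))
    A ?_
  intro z hz
  obtain ⟨w, hw, hrel, q, hq, rfl⟩ := hA z hz
  rw [phiWord_eq m d g l p (phiWord m d g l w q), phiWord_eq m d g l w q, hw]
  exact ⟨coord_bound hg (hK q hq).1 hc hrel.1, coord_bound hl (hK q hq).2 hc hrel.2⟩

theorem core_bound {m : ℕ} (hm : 2 ≤ m) {d : Fin m → ℝ} {g l : ℝ} (hg : 0 < g) (hgl : g < l)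
    (hl1 : l < 1) {s : ℝ} (hs : s = 1 + Real.log (m * l) / Real.log (1 / g)) (hs0 : 0 ≤ s)
    {B0 : ℝ} (hB0 : 0 ≤ B0) (hK : ∀ q ∈ Kaff m d g l, q.1 ∈ Icc 0 B0 ∧ q.2 ∈ Icc 0 B0)
    {r : ℝ≥0∞} (hr : 0 < r) (k : ℕ) (W : Finset (List.Vector (Fin m) k)) (hWn : W.Nonempty)
    {c : ℝ} (hc : c ≤ 1)
    (hW : ∀ w ∈ W, ∀ w' ∈ W, RelClose m d g l c k w.toList w'.toList) :
    preH s r (Kaff m d g l) ≤ ENNReal.ofReal (2 * (B0 + 2) ^ s / W.card) := by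
  classical
  have hm0 : (0 : ℝ) < m := by exact_mod_cast (by omega : 0 < m)
  have hg1 : g < 1 := hgl.trans hl1
  set C := 2 * (B0 + 2) ^ s with hC
  have hC0 : 0 ≤ C := by positivity
  set K := Kaff m d g l with hKdef
  -- the scale
  obtain ⟨n0, hn0⟩ : ∃ n0 : ℕ, ∀ n ≥ n0, ENNReal.ofReal ((B0 + 2) * g ^ n) ≤ r := by
    have ht : Tendsto (fun n : ℕ => ENNReal.ofReal ((B0 + 2) * g ^ n)) atTop (𝓝 0) := by
      rw [← ENNReal.ofReal_zero]
      apply ENNReal.tendsto_ofReal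
      have := (tendsto_pow_atTop_nhds_zero_of_lt_one hg.le hg1).const_mul (B0 + 2)
      rwa [mul_zero] at this
    exact eventually_atTop.1 (ht.eventually_le_const hr)
  set S : List (Fin m) → ℝ≥0∞ := fun p => preH s r (phiWord m d g l p '' K) with hS
  have hsingle : ∀ p : List (Fin m), n0 ≤ p.length → S p ≤ ENNReal.ofReal (C / m ^ p.length) := by
    intro p hp
    have := cluster_cost hm hg hgl hl1 hs hs0 hB0 hK p 0 (r := r) (hn0 _ (by omega)) hc []
      (phiWord m d g l p '' K) ?_
    · simpa using this
    · rintro z ⟨q, hq, rfl⟩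
      refine ⟨[], rfl, ?_, q, hq, rfl⟩
      obtain ⟨w, hw⟩ := hWn
      have hcn : 0 ≤ c := by
        have h1 := (abs_nonneg _).trans (hW w hw w hw).1
        exact nonneg_of_mul_nonneg_left h1 (by positivity)
      exact relClose_self hg hgl hcn _ _
  have hfin : ∀ p : List (Fin m), n0 ≤ p.length → S p ≠ ∞ := fun p hp =>
    ((hsingle p hp).trans_lt ENNReal.ofReal_lt_top).ne
  have hstep : ∀ p : List (Fin m), n0 ≤ p.length →
      S p ≤ ENNReal.ofReal (C / m ^ (p.length + k)) + ∑ w ∈ Wᶜ, S (p ++ w.toList) := by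
    intro p hp
    have hsub : phiWord m d g l p '' K ⊆
        (⋃ w ∈ W, phiWord m d g l (p ++ w.toList) '' K) ∪
          ⋃ w ∈ Wᶜ, phiWord m d g l (p ++ w.toList) '' K := by
      rintro z ⟨q, hq, rfl⟩
      obtain ⟨w, q', hq', rfl⟩ := mem_iUnion.1 (Kaff_subset d hg hgl hl1 k hq)
      have hz : phiWord m d g l p (phiWord m d g l w.toList q') ∈
          phiWord m d g l (p ++ w.toList) '' K := ⟨q', hq', by rw [phiWord_append]; rfl⟩
      by_cases hw : w ∈ W
      · exact Or.inl (mem_iUnion₂.2 ⟨w, hw, hz⟩)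
      · exact Or.inr (mem_iUnion₂.2 ⟨w, Finset.mem_compl.2 hw, hz⟩)
    refine (measure_mono hsub).trans ((measure_union_le _ _).trans (add_le_add ?_ ?_))
    · obtain ⟨w0, hw0⟩ := hWn
      refine cluster_cost hm hg hgl hl1 hs hs0 hB0 hK p k (r := r) (hn0 _ (by omega)) hc w0.toList
        _ ?_
      intro z hz
      obtain ⟨w, hw, q, hq, rfl⟩ := mem_iUnion₂.1 hz
      exact ⟨w.toList, by simp, hW w hw w0 hw0, q, hq, by rw [phiWord_append]; rfl⟩
    · exact measure_biUnion_finset_le _ _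
  -- normalised supremum
  let F : {p : List (Fin m) // n0 ≤ p.length} → ℝ := fun p => m ^ p.1.length * (S p.1).toReal
  have hbdd : BddAbove (range F) := by
    refine ⟨C, ?_⟩
    rintro _ ⟨⟨p, hp⟩, rfl⟩
    have h := ENNReal.toReal_mono ENNReal.ofReal_ne_top (hsingle p hp)
    rw [ENNReal.toReal_ofReal (by positivity), le_div_iff₀ (by positivity)] at h
    change m ^ p.length * (S p).toReal ≤ C
    linarith
  have : Nonempty {p : List (Fin m) // n0 ≤ p.length} :=
    ⟨⟨List.replicate n0 ⟨0, by omega⟩, by simp⟩⟩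
  set T := ⨆ p, F p with hT
  have hFT : ∀ p : List (Fin m), n0 ≤ p.length → (S p).toReal ≤ T / m ^ p.length := by
    intro p hp
    have : m ^ p.length * (S p).toReal ≤ T := le_ciSup hbdd ⟨p, hp⟩
    rw [le_div_iff₀ (by positivity)]; linarith
  have hcardc : ((Wᶜ.card : ℕ) : ℝ) = (m : ℝ) ^ k - W.card := by
    rw [Finset.card_compl, Nat.cast_sub (Finset.card_le_univ _), card_vector]
    simp
  have hTle : T ≤ C / m ^ k + ((m : ℝ) ^ k - W.card) * (T / m ^ k) := by
    refine ciSup_le ?_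
    rintro ⟨p, hp⟩
    have hlen : ∀ w : List.Vector (Fin m) k, (p ++ w.toList).length = p.length + k := by simp
    have hpw : ∀ w : List.Vector (Fin m) k, n0 ≤ (p ++ w.toList).length := fun w => by
      rw [hlen]; omega
    have hsf : ∑ w ∈ Wᶜ, S (p ++ w.toList) ≠ ∞ :=
      ENNReal.sum_ne_top.2 fun w _ => hfin _ (hpw w)
    have h := ENNReal.toReal_mono (ENNReal.add_ne_top.2 ⟨ENNReal.ofReal_ne_top, hsf⟩) (hstep p hp)
    rw [ENNReal.toReal_add ENNReal.ofReal_ne_top hsf, ENNReal.toReal_ofReal (by positivity),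
      ENNReal.toReal_sum fun w _ => hfin _ (hpw w)] at h
    have h2 : ∑ w ∈ Wᶜ, (S (p ++ w.toList)).toReal ≤
        ((m : ℝ) ^ k - W.card) * (T / m ^ (p.length + k)) := by
      rw [← hcardc, ← nsmul_eq_mul]
      refine Finset.sum_le_card_nsmul _ _ _ fun w _ => ?_
      have := hFT _ (hpw w)
      rwa [hlen] at this
    change m ^ p.length * (S p).toReal ≤ _
    calc (m : ℝ) ^ p.length * (S p).toReal ≤ m ^ p.length * (C / m ^ (p.length + k) +
          ((m : ℝ) ^ k - W.card) * (T / m ^ (p.length + k))) := by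
          gcongr; linarith
      _ = _ := by rw [pow_add]; field_simp
  have hcp : (0 : ℝ) < W.card := by exact_mod_cast hWn.card_pos
  have hTC : T ≤ C / W.card := by
    rw [le_div_iff₀ hcp]
    have hmk : (0 : ℝ) < m ^ k := by positivity
    have e : C / (m : ℝ) ^ k + ((m : ℝ) ^ k - W.card) * (T / m ^ k) =
        T + (C - T * W.card) / m ^ k := by field_simp; ring
    rw [e] at hTle
    have : 0 ≤ (C - T * W.card) / (m : ℝ) ^ k := by linarith
    rw [le_div_iff₀ hmk, zero_mul] at this
    linarith
  calc preH s r K ≤ ∑ v : List.Vector (Fin m) n0, S v.toList :=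
        (measure_mono (Kaff_subset d hg hgl hl1 n0)).trans (measure_iUnion_fintype_le _ _)
    _ ≤ ∑ v : List.Vector (Fin m) n0, ENNReal.ofReal (T / m ^ n0) := by
        refine Finset.sum_le_sum fun v _ => ?_
        have hv : n0 ≤ v.toList.length := by simp
        have := hFT v.toList hv
        rw [List.Vector.toList_length] at this
        exact ENNReal.le_ofReal_iff_toReal_le (hfin _ hv) (ENNReal.toReal_nonneg.trans this) |>.2 this
    _ = ENNReal.ofReal T := by
        rw [Finset.sum_const, Finset.card_univ, card_vector, Fintype.card_fin, nsmul_eq_mul,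
          ← ENNReal.ofReal_natCast, ← ENNReal.ofReal_mul (by positivity)]
        congr 1
        push_cast
        field_simp
    _ ≤ _ := ENNReal.ofReal_le_ofReal hTC

/-- If for every `ε > 0` there are distinct words `u ≠ v` of equal length such that
`(φ_u)⁻¹ ∘ φ_v` (an affine map with linear part `L` and translation `t`) satisfies
`‖L − I‖ + |t| < ε`, then `ℋ^s(K_{γ,λ}) = 0` for `s = 1 + log(mλ)/log(1/γ)`. -/
theorem zero_hausdorff_measure_of_relatively_close_cylinders
    (m : ℕ) (hm : 2 ≤ m) (d : Fin m → ℝ) (hd0 : d ⟨0, by omega⟩ = 0) (hd : StrictMono d)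
    (g l : ℝ) (hg : 0 < g) (hgl : g < l) (hl1 : l < 1)
    (hlm : 1 / (m : ℝ) < l) (hglm : g * l < 1 / (m : ℝ))
    (hclose : ∀ ε : ℝ, 0 < ε → ∃ u v : List (Fin m), u.length = v.length ∧ u ≠ v ∧
      ∃ (L : (ℝ × ℝ) →L[ℝ] (ℝ × ℝ)) (t : ℝ × ℝ),
        (∀ p : ℝ × ℝ, phiWord m d g l u (L p + t) = phiWord m d g l v p) ∧
        ‖L - ContinuousLinearMap.id ℝ (ℝ × ℝ)‖ + ‖t‖ < ε) :
    μH[1 + Real.log (m * l) / Real.log (1 / g)] (Kaff m d g l) = 0 := by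
  have hm0 : (0 : ℝ) < m := by exact_mod_cast (by omega : 0 < m)
  have hl : 0 < l := hg.trans hgl
  have hg1 : g < 1 := hgl.trans hl1
  have hml : 1 < (m : ℝ) * l := by
    rw [div_lt_iff₀ hm0] at hlm; linarith
  obtain ⟨s, hs⟩ : ∃ s, s = 1 + Real.log (m * l) / Real.log (1 / g) := ⟨_, rfl⟩
  have hs0 : 0 ≤ s := by
    have h1 := Real.log_pos hml
    have h2 := Real.log_pos (one_lt_one_div hg hg1)
    rw [hs]; positivity
  rw [← hs]
  obtain ⟨D, hD0, hD⟩ := exists_bound d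
  have hdn : ∀ i, 0 ≤ d i := fun i => by
    rw [← hd0]; exact hd.monotone (Fin.mk_le_of_le_val (Nat.zero_le _))
  have hB0 : 0 ≤ D * (1 - l)⁻¹ := mul_nonneg hD0 (inv_nonneg.2 (by linarith))
  have hK : ∀ q ∈ Kaff m d g l, q.1 ∈ Icc 0 (D * (1 - l)⁻¹) ∧ q.2 ∈ Icc 0 (D * (1 - l)⁻¹) := by
    rintro q ⟨ω, rfl⟩
    exact ⟨digit_bound d hg hgl.le hl1 hdn hD ω, digit_bound d hl le_rfl hl1 hdn hD ω⟩
  set B := D * (1 - l)⁻¹ + 2 with hB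
  have hpair := close_pair hg hgl hclose
  rw [Measure.hausdorffMeasure, ← Measure.coe_toOuterMeasure, Measure.mkMetric_toOuterMeasure, OuterMeasure.mkMetric,
    OuterMeasure.mkMetric', OuterMeasure.iSup_apply]
  simp only [OuterMeasure.iSup_apply, ENNReal.iSup_eq_zero]
  intro r hr
  change preH s r (Kaff m d g l) = 0
  have hlim : ∀ N : ℕ, preH s r (Kaff m d g l) ≤ ENNReal.ofReal (2 * B ^ s * (1 / 2) ^ N) := by
    intro N
    rw [one_div_pow, mul_one_div]
    obtain ⟨k, c, W, hc0, hc1, hcard, hW⟩ := many_close hg hgl hpair N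
    rw [show ((2 : ℝ) ^ N) = ((W.card : ℕ) : ℝ) by rw [hcard]; push_cast; rfl]
    exact core_bound hm hg hgl hl1 hs hs0 hB0 hK hr k W
      (Finset.card_pos.1 (by rw [hcard]; positivity)) hc1.le hW
  have ht : Tendsto (fun N : ℕ => ENNReal.ofReal (2 * B ^ s * (1 / 2) ^ N)) atTop (𝓝 0) := by
    rw [← ENNReal.ofReal_zero]
    apply ENNReal.tendsto_ofReal
    have := (tendsto_pow_atTop_nhds_zero_of_lt_one (r := (1 / 2 : ℝ)) (by norm_num)
      (by norm_num)).const_mul (2 * B ^ s)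
    rwa [mul_zero] at this
  exact le_antisymm (ge_of_tendsto' ht hlim) (zero_le)
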